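/- Suppose an inner loop is executed k times in succession, where the first execution runs n₁ ≥ 3 iterations and every subsequent execution runs nᵢ ≥ 1 iterations. Then for every initial predictor state s, the total number of mispredictions of the inner loop's condition branch is approximately k, namely between k and k + 2. Formally: for every nonempty list ns : List ℕ with ns.head ≥ 3 and every element of ns.tail at least 1, and every initial state s, ns.length ≤ misses s ((ns.map loopSeq).flatten) ≤ ns.length + 2. -/

import Mathlib

/-- One update of the 2-bit saturating-counter branch predictor:
states `0,1,2,3` = Strongly-Not-Taken, Weakly-Not-Taken, Weakly-Taken, Strongly-Taken. -/
def step (s : ℕ) (b : Bool) : ℕ := if b then min (s + 1) 3 else s - 1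

/-- Final predictor state after processing the outcome list `L` from initial state `s`. -/
def run (s : ℕ) (L : List Bool) : ℕ := L.foldl step s

/-- Number of mispredictions: positions `i` where the prediction (`taken` iff state ≥ 2)
of the state after the first `i` outcomes differs from the actual outcome `L.get i`. -/
def misses (s : ℕ) (L : List Bool) : ℕ :=
  (List.finRange L.length).countP (fun i : Fin L.length => decide (2 ≤ run s (L.take i.val)) != L.get i)

/-- Outcome list of the condition branch of a simple sequential loop executing `n` times. -/
def loopSeq (n : ℕ) : List Bool := List.replicate n true ++ [false]

theorem misses_nil' (s : ℕ) : misses s [] = 0 := by simp [misses]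

theorem misses_cons' (s : ℕ) (b : Bool) (L : List Bool) :
    misses s (b :: L) = (if (decide (2 ≤ s) != b) = true then 1 else 0) + misses (step s b) L := by
  unfold misses
  simp only [List.length_cons, List.finRange_succ, List.countP_cons, List.countP_map]
  rw [Nat.add_comm]
  congr 1

theorem misses_three (n : ℕ) (L : List Bool) :
    misses 3 (List.replicate n true ++ false :: L) = 1 + misses 2 L := by
  induction n with
  | zero => simp [misses_cons', step]
  | succ k ih => simp [List.replicate_succ, misses_cons', step, ih]

theorem misses_rest (ns : List ℕ) (h : ∀ m ∈ ns, 1 ≤ m) :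
    misses 2 ((ns.map loopSeq).flatten) = ns.length := by
  induction ns with
  | nil => simp [misses_nil']
  | cons m ms ih =>
    have hm : 1 ≤ m := h m (by simp)
    obtain ⟨k, rfl⟩ := Nat.exists_eq_add_of_le' hm
    have ih' := ih (fun x hx => h x (by simp [hx]))
    have e : (((k + 1) :: ms).map loopSeq).flatten
        = true :: (List.replicate k true ++ false :: (ms.map loopSeq).flatten) := by
      simp [loopSeq, List.replicate_succ]
    rw [e, misses_cons']
    have h3 : step 2 true = 3 := by simp [step]
    rw [h3, misses_three, ih']
    simp [Nat.add_comm]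

theorem stmt6 (n : ℕ) (rest : List ℕ) (hn : 3 ≤ n) (hrest : ∀ m ∈ rest, 1 ≤ m)
    (s : ℕ) (hs : s ≤ 3) :
    (n :: rest).length ≤ misses s (((n :: rest).map loopSeq).flatten) ∧
      misses s (((n :: rest).map loopSeq).flatten) ≤ (n :: rest).length + 2 := by
  obtain ⟨k, rfl⟩ := Nat.exists_eq_add_of_le' hn
  have e : (((k + 3) :: rest).map loopSeq).flatten
      = true :: true :: true :: (List.replicate k true ++ false :: (rest.map loopSeq).flatten) := by
    simp [loopSeq, List.replicate_succ]
  have h3 : step (step (step s true) true) true = 3 := by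
    simp only [step, if_true]; omega
  rw [e, misses_cons', misses_cons', misses_cons', h3, misses_three, misses_rest rest hrest]
  interval_cases s <;> simp [step] <;> omega
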